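/- (Singleton model set: the minimax estimator is the Kalman filter.) Let F ∈ ℝ^{n×n}, H ∈ ℝ^{m×n}, let Q, P₀ ∈ ℝ^{n×n} and R ∈ ℝ^{m×m} be symmetric positive definite, γ > 0, x̂₀ ∈ ℝⁿ, measurements y₀,…,y_{N−1} ∈ ℝ^m, and define P_t, x̆_t, c_t by the Kalman recursions (see context). If H P_N Hᵀ ≺ γ² I, then the function ŷ ↦ sup over state trajectories x : {0,…,N} → ℝⁿ of [ |ŷ − H x_N|² − γ² ( |x₀ − x̂₀|²_{P₀⁻¹} + Σ_{t=0}^{N−1} ( |x_{t+1} − F x_t|²_{Q⁻¹} + |y_t − H x_t|²_{R⁻¹} ) ) ] attains its infimum over ŷ ∈ ℝ^m uniquely at ŷ* = H x̆_N, and the minimax value equals −γ² c_N. -/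

import Mathlib

open Matrix

/-- Weighted squared norm `|z|²_M = zᵀ M z`. -/
noncomputable def qf {k : ℕ} (M : Matrix (Fin k) (Fin k) ℝ) (z : Fin k → ℝ) : ℝ :=
  z ⬝ᵥ M *ᵥ z

lemma qf_add {k : ℕ} {M : Matrix (Fin k) (Fin k) ℝ} (hM : M.PosDef) (a b : Fin k → ℝ) :
    qf M (a + b) = qf M a + 2 * (a ⬝ᵥ M *ᵥ b) + qf M b := by
  have hs : b ⬝ᵥ M *ᵥ a = a ⬝ᵥ M *ᵥ b := by
    have hT : Mᵀ = M := by simpa using hM.isHermitian.eq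
    rw [dotProduct_comm, dotProduct_comm a, dotProduct_comm, dotProduct_mulVec,
      ← mulVec_transpose, hT]
  simp only [qf, mulVec_add, dotProduct_add, add_dotProduct, hs]
  ring

lemma qf_neg {k : ℕ} (M : Matrix (Fin k) (Fin k) ℝ) (a : Fin k → ℝ) : qf M (-a) = qf M a := by
  simp [qf, mulVec_neg]

lemma qf_zero {k : ℕ} (M : Matrix (Fin k) (Fin k) ℝ) : qf M 0 = 0 := by simp [qf]

lemma qf_nonneg {k : ℕ} {M : Matrix (Fin k) (Fin k) ℝ} (hM : M.PosDef) (a : Fin k → ℝ) :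
    0 ≤ qf M a := by
  simpa [qf] using hM.posSemidef.dotProduct_mulVec_nonneg a

lemma qf_add_left {k : ℕ} (A B : Matrix (Fin k) (Fin k) ℝ) (z : Fin k → ℝ) :
    qf (A + B) z = qf A z + qf B z := by
  simp [qf, add_mulVec, dotProduct_add]

lemma inv_mulVec_mulVec {k : ℕ} {M : Matrix (Fin k) (Fin k) ℝ} (hM : M.PosDef) (a : Fin k → ℝ) :
    M⁻¹ *ᵥ (M *ᵥ a) = a := by
  rw [mulVec_mulVec, nonsing_inv_mul M ((isUnit_iff_isUnit_det M).1 hM.isUnit), one_mulVec]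

lemma qf_inv_mulVec {k : ℕ} {M : Matrix (Fin k) (Fin k) ℝ} (hM : M.PosDef) (a : Fin k → ℝ) :
    qf M⁻¹ (M *ᵥ a) = qf M a := by
  simp only [qf, inv_mulVec_mulVec hM]
  exact dotProduct_comm _ _

lemma qf_conj {k l : ℕ} (H : Matrix (Fin l) (Fin k) ℝ) (M : Matrix (Fin l) (Fin l) ℝ)
    (a : Fin k → ℝ) : qf (Hᵀ * M * H) a = qf M (H *ᵥ a) := by
  simp only [qf, ← mulVec_mulVec]
  rw [dotProduct_mulVec, vecMul_transpose]

lemma posDef_add_conj {k l : ℕ} {R : Matrix (Fin l) (Fin l) ℝ} {P : Matrix (Fin k) (Fin k) ℝ}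
    (hR : R.PosDef) (hP : P.PosDef) (H : Matrix (Fin l) (Fin k) ℝ) :
    (R + H * P * Hᵀ).PosDef := by
  have h := hP.posSemidef.mul_mul_conjTranspose_same H
  rw [conjTranspose_eq_transpose_of_trivial] at h
  exact hR.add_posSemidef h

/-- Completion of squares for the measurement update, with gain `P Hᵀ (R + H P Hᵀ)⁻¹`. -/
lemma qf_measurement_update {k l : ℕ} {R : Matrix (Fin l) (Fin l) ℝ}
    {P : Matrix (Fin k) (Fin k) ℝ} (hR : R.PosDef) (hP : P.PosDef) (H : Matrix (Fin l) (Fin k) ℝ)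
    (e : Fin k → ℝ) (v : Fin l → ℝ) :
    qf P⁻¹ e + qf R⁻¹ (v - H *ᵥ e) =
      qf (P⁻¹ + Hᵀ * R⁻¹ * H) (e - (P * Hᵀ * (R + H * P * Hᵀ)⁻¹) *ᵥ v) +
        qf (R + H * P * Hᵀ)⁻¹ v := by
  have hS := posDef_add_conj hR hP H
  have hSu : IsUnit (R + H * P * Hᵀ).det := (isUnit_iff_isUnit_det _).1 hS.isUnit
  obtain ⟨u, rfl⟩ : ∃ u, v = (R + H * P * Hᵀ) *ᵥ u :=
    ⟨(R + H * P * Hᵀ)⁻¹ *ᵥ v, by rw [mulVec_mulVec, mul_nonsing_inv _ hSu, one_mulVec]⟩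
  have hgain : (P * Hᵀ * (R + H * P * Hᵀ)⁻¹) *ᵥ ((R + H * P * Hᵀ) *ᵥ u) = P *ᵥ (Hᵀ *ᵥ u) := by
    rw [mulVec_mulVec, Matrix.mul_assoc (P * Hᵀ), nonsing_inv_mul _ hSu, Matrix.mul_one,
      mulVec_mulVec]
  rw [hgain, qf_inv_mulVec hS]
  obtain ⟨a, rfl⟩ : ∃ a, e = a + P *ᵥ (Hᵀ *ᵥ u) := ⟨e - P *ᵥ (Hᵀ *ᵥ u), by abel⟩
  have hres : (R + H * P * Hᵀ) *ᵥ u - H *ᵥ (a + P *ᵥ (Hᵀ *ᵥ u)) = -(H *ᵥ a) + R *ᵥ u := by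
    simp only [add_mulVec, mulVec_add, ← mulVec_mulVec]
    abel
  have hsplit : qf (R + H * P * Hᵀ) u = qf R u + qf P (Hᵀ *ᵥ u) := by
    rw [← qf_conj, transpose_transpose, qf_add_left]
  rw [hres, add_sub_cancel_right, qf_add hP.inv, qf_add hR.inv, qf_inv_mulVec hP,
    qf_inv_mulVec hR, qf_neg, qf_add_left, hsplit, qf_conj, inv_mulVec_mulVec hP,
    inv_mulVec_mulVec hR, neg_dotProduct, dotProduct_mulVec a, vecMul_transpose]
  ring

lemma posDef_information {k l : ℕ} {R : Matrix (Fin l) (Fin l) ℝ} {P : Matrix (Fin k) (Fin k) ℝ}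
    (hR : R.PosDef) (hP : P.PosDef) (H : Matrix (Fin l) (Fin k) ℝ) :
    (P⁻¹ + Hᵀ * R⁻¹ * H).PosDef := by
  simpa using posDef_add_conj hP.inv hR.inv Hᵀ

lemma inv_information {k l : ℕ} {R : Matrix (Fin l) (Fin l) ℝ} {P : Matrix (Fin k) (Fin k) ℝ}
    (hR : R.PosDef) (hP : P.PosDef) (H : Matrix (Fin l) (Fin k) ℝ) :
    (P⁻¹ + Hᵀ * R⁻¹ * H)⁻¹ = P - P * Hᵀ * (R + H * P * Hᵀ)⁻¹ * H * P := by
  have hPu : IsUnit P.det := (isUnit_iff_isUnit_det _).1 hP.isUnit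
  have hRu : IsUnit R.det := (isUnit_iff_isUnit_det _).1 hR.isUnit
  have hS : IsUnit ((R⁻¹)⁻¹ + H * (P⁻¹)⁻¹ * Hᵀ) := by
    rw [nonsing_inv_nonsing_inv _ hPu, nonsing_inv_nonsing_inv _ hRu]
    exact (posDef_add_conj hR hP H).isUnit
  rw [add_mul_mul_inv_eq_sub _ _ _ _ hP.inv.isUnit hR.inv.isUnit hS,
    nonsing_inv_nonsing_inv _ hPu, nonsing_inv_nonsing_inv _ hRu]

/-- One Bellman step of the filter: partial minimisation over the previous state. -/
lemma qf_filter_step {n m : ℕ} {Q P : Matrix (Fin n) (Fin n) ℝ} {R : Matrix (Fin m) (Fin m) ℝ}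
    (hQ : Q.PosDef) (hP : P.PosDef) (hR : R.PosDef)
    (F : Matrix (Fin n) (Fin n) ℝ) (H : Matrix (Fin m) (Fin n) ℝ)
    {P' : Matrix (Fin n) (Fin n) ℝ} {xb xb' : Fin n → ℝ} {y : Fin m → ℝ}
    (hP' : P' = Q + F * P * Fᵀ - F * P * Hᵀ * (R + H * P * Hᵀ)⁻¹ * (H * P * Fᵀ))
    (hx' : xb' = F *ᵥ xb + (F * P * Hᵀ * (R + H * P * Hᵀ)⁻¹) *ᵥ (y - H *ᵥ xb)) :
    P'.PosDef ∧
    (∀ x z, qf P'⁻¹ (z - xb') + qf (R + H * P * Hᵀ)⁻¹ (H *ᵥ xb - y) ≤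
      qf P⁻¹ (x - xb) + (qf Q⁻¹ (z - F *ᵥ x) + qf R⁻¹ (y - H *ᵥ x))) ∧
    (∀ z, ∃ x, qf P⁻¹ (x - xb) + (qf Q⁻¹ (z - F *ᵥ x) + qf R⁻¹ (y - H *ᵥ x)) =
      qf P'⁻¹ (z - xb') + qf (R + H * P * Hᵀ)⁻¹ (H *ᵥ xb - y)) := by
  have hI := posDef_information hR hP H
  have hIu : IsUnit (P⁻¹ + Hᵀ * R⁻¹ * H).det := (isUnit_iff_isUnit_det _).1 hI.isUnit
  have hM := inv_information hR hP H
  have hPM : P' = Q + F * (P⁻¹ + Hᵀ * R⁻¹ * H)⁻¹ * Fᵀ := by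
    rw [hP', hM]
    simp only [Matrix.mul_sub, Matrix.sub_mul, Matrix.mul_assoc]
    abel
  set L := P * Hᵀ * (R + H * P * Hᵀ)⁻¹ with hL
  set G := (P⁻¹ + Hᵀ * R⁻¹ * H)⁻¹ with hG
  have hxL : xb' = F *ᵥ xb + F *ᵥ (L *ᵥ (y - H *ᵥ xb)) := by
    rw [hx', hL, mulVec_mulVec _ F]
    simp only [Matrix.mul_assoc]
  have hsum : ∀ x z, qf P⁻¹ (x - xb) + (qf Q⁻¹ (z - F *ᵥ x) + qf R⁻¹ (y - H *ᵥ x)) =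
      qf (G⁻¹ + Fᵀ * Q⁻¹ * F) (x - xb - L *ᵥ (y - H *ᵥ xb) - (G * Fᵀ * P'⁻¹) *ᵥ (z - xb')) +
        (qf P'⁻¹ (z - xb') + qf (R + H * P * Hᵀ)⁻¹ (H *ᵥ xb - y)) := by
    intro x z
    have h1 := qf_measurement_update hR hP H (x - xb) (y - H *ᵥ xb)
    have h2 := qf_measurement_update hQ hI.inv F (x - xb - L *ᵥ (y - H *ᵥ xb)) (z - xb')
    have e1 : y - H *ᵥ xb - H *ᵥ (x - xb) = y - H *ᵥ x := by rw [mulVec_sub]; abel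
    have e2 : z - xb' - F *ᵥ (x - xb - L *ᵥ (y - H *ᵥ xb)) = z - F *ᵥ x := by
      rw [hxL, mulVec_sub F, mulVec_sub F]; abel
    have e3 : G⁻¹ = P⁻¹ + Hᵀ * R⁻¹ * H := nonsing_inv_nonsing_inv _ hIu
    rw [e1, ← hL, ← e3] at h1
    rw [e2, ← hG, ← hPM] at h2
    rw [← neg_sub y, qf_neg]
    linarith
  refine ⟨hPM ▸ posDef_add_conj hQ hI.inv F, fun x z => ?_, fun z => ?_⟩
  · rw [hsum]
    linarith [qf_nonneg (posDef_information hQ hI.inv F)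
      (x - xb - L *ᵥ (y - H *ᵥ xb) - (G * Fᵀ * P'⁻¹) *ᵥ (z - xb'))]
  · refine ⟨xb + L *ᵥ (y - H *ᵥ xb) + (G * Fᵀ * P'⁻¹) *ᵥ (z - xb'), ?_⟩
    rw [hsum, add_assoc xb, add_sub_cancel_left, add_sub_cancel_left, sub_self, qf_zero, zero_add]

/-- If `H P Hᵀ ≺ γ² I`, then `|d - H e|² - γ² |e|²_{P⁻¹}` is bounded above in `e`, by a bound that
vanishes for `d = 0`. -/
lemma sub_sq_le_of_posDef {n m : ℕ} {P : Matrix (Fin n) (Fin n) ℝ} (hP : P.PosDef)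
    {H : Matrix (Fin m) (Fin n) ℝ} {γ : ℝ} (hγ : 0 < γ)
    (hS : (γ ^ 2 • (1 : Matrix (Fin m) (Fin m) ℝ) - H * P * Hᵀ).PosDef)
    (d : Fin m → ℝ) (e : Fin n → ℝ) :
    (d - H *ᵥ e) ⬝ᵥ (d - H *ᵥ e) - γ ^ 2 * qf P⁻¹ e ≤
      d ⬝ᵥ d + γ ^ 2 * qf (γ ^ 2 • (1 : Matrix (Fin m) (Fin m) ℝ) - H * P * Hᵀ)⁻¹ d := by
  set S := γ ^ 2 • (1 : Matrix (Fin m) (Fin m) ℝ) - H * P * Hᵀ with hSdef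
  have hSu : IsUnit S.det := (isUnit_iff_isUnit_det _).1 hS.isUnit
  set w := H *ᵥ e with hw
  have hSw : qf S w = γ ^ 2 * (w ⬝ᵥ w) - qf P (Hᵀ *ᵥ w) := by
    rw [← qf_conj Hᵀ, transpose_transpose]
    simp [qf, hSdef, sub_mulVec, dotProduct_sub, smul_mulVec, dotProduct_smul]
  have h1 : 0 ≤ γ ^ 4 * qf P⁻¹ e - 2 * γ ^ 2 * (w ⬝ᵥ w) + qf P (Hᵀ *ᵥ w) := by
    have h := qf_nonneg hP.inv (-(γ ^ 2 • e) + P *ᵥ (Hᵀ *ᵥ w))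
    rw [qf_add hP.inv, qf_inv_mulVec hP, qf_neg, inv_mulVec_mulVec hP,
      neg_dotProduct, smul_dotProduct, dotProduct_mulVec e, vecMul_transpose,
      ← hw] at h
    have hsm : qf P⁻¹ (γ ^ 2 • e) = γ ^ 4 * qf P⁻¹ e := by
      simp only [qf, mulVec_smul, dotProduct_smul, smul_dotProduct, smul_eq_mul]
      ring
    rw [hsm, smul_eq_mul] at h
    linarith
  have h2 : 0 ≤ qf S w + 2 * γ ^ 2 * (d ⬝ᵥ w) + γ ^ 4 * qf S⁻¹ d := by
    have h := qf_nonneg hS (w + γ ^ 2 • (S⁻¹ *ᵥ d))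
    rw [qf_add hS, mulVec_smul, mulVec_mulVec, mul_nonsing_inv _ hSu, one_mulVec,
      dotProduct_smul, dotProduct_comm w d] at h
    have hsm : qf S (γ ^ 2 • (S⁻¹ *ᵥ d)) = γ ^ 4 * qf S⁻¹ d := by
      simp only [qf, mulVec_smul, dotProduct_smul, smul_dotProduct, smul_eq_mul,
        mulVec_mulVec, mul_nonsing_inv _ hSu, one_mulVec]
      rw [dotProduct_comm]
      ring
    rw [hsm, smul_eq_mul] at h
    linarith
  have h3 : (d - w) ⬝ᵥ (d - w) = d ⬝ᵥ d - 2 * (d ⬝ᵥ w) + w ⬝ᵥ w := by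
    simp only [dotProduct_sub, sub_dotProduct, dotProduct_comm w d]
    ring
  rw [h3]
  refine le_of_mul_le_mul_left ?_ (by positivity : 0 < γ ^ 2)
  rw [hSw] at h2
  linarith

/-- (Singleton model set: the minimax estimator is the Kalman filter.) If
`H P_N Hᵀ ≺ γ² I`, then `ŷ ↦ sup_{x(·)} [ |ŷ − H x_N|² − γ² (...) ]` attains its
infimum uniquely at `ŷ* = H x̆_N`, and the minimax value equals `−γ² c_N`. -/
theorem singleton_minimax_is_kalman {n m N : ℕ}
    (F : Matrix (Fin n) (Fin n) ℝ) (H : Matrix (Fin m) (Fin n) ℝ)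
    (Q P₀ : Matrix (Fin n) (Fin n) ℝ) (R : Matrix (Fin m) (Fin m) ℝ)
    (hQ : Q.PosDef) (hP₀ : P₀.PosDef) (hR : R.PosDef)
    (γ : ℝ) (hγ : 0 < γ)
    (xh₀ : Fin n → ℝ) (y : ℕ → Fin m → ℝ)
    (P : ℕ → Matrix (Fin n) (Fin n) ℝ)
    (xbr : ℕ → Fin n → ℝ) (c : ℕ → ℝ)
    (hP0 : P 0 = P₀)
    (hPrec : ∀ t, P (t + 1) =
      Q + F * P t * Fᵀ - F * P t * Hᵀ * (R + H * P t * Hᵀ)⁻¹ * (H * P t * Fᵀ))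
    (hx0 : xbr 0 = xh₀)
    (hxrec : ∀ t, xbr (t + 1) =
      F *ᵥ xbr t + (F * P t * Hᵀ * (R + H * P t * Hᵀ)⁻¹) *ᵥ (y t - H *ᵥ xbr t))
    (hc0 : c 0 = 0)
    (hcrec : ∀ t, c (t + 1) = c t + qf (R + H * P t * Hᵀ)⁻¹ (H *ᵥ xbr t - y t))
    (hgam : (γ ^ 2 • (1 : Matrix (Fin m) (Fin m) ℝ) - H * P N * Hᵀ).PosDef) :
    let g : (Fin m → ℝ) → ℝ := fun yh =>
      ⨆ x : ℕ → Fin n → ℝ,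
        ((yh - H *ᵥ x N) ⬝ᵥ (yh - H *ᵥ x N) -
          γ ^ 2 * (qf P₀⁻¹ (x 0 - xh₀) +
            ∑ t ∈ Finset.range N,
              (qf Q⁻¹ (x (t + 1) - F *ᵥ x t) + qf R⁻¹ (y t - H *ᵥ x t))))
    (∀ yh : Fin m → ℝ, g (H *ᵥ xbr N) ≤ g yh) ∧
      (∀ yh : Fin m → ℝ, g yh = g (H *ᵥ xbr N) → yh = H *ᵥ xbr N) ∧
      g (H *ᵥ xbr N) = -(γ ^ 2 * c N) := by
  intro g
  have key : ∀ t, (P t).PosDef ∧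
      (∀ x : ℕ → Fin n → ℝ, qf (P t)⁻¹ (x t - xbr t) + c t ≤ qf P₀⁻¹ (x 0 - xh₀) +
        ∑ s ∈ Finset.range t, (qf Q⁻¹ (x (s + 1) - F *ᵥ x s) + qf R⁻¹ (y s - H *ᵥ x s))) ∧
      (∀ z, ∃ x : ℕ → Fin n → ℝ, x t = z ∧ qf P₀⁻¹ (x 0 - xh₀) +
        ∑ s ∈ Finset.range t, (qf Q⁻¹ (x (s + 1) - F *ᵥ x s) + qf R⁻¹ (y s - H *ᵥ x s)) =
          qf (P t)⁻¹ (z - xbr t) + c t) := by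
    intro t
    induction t with
    | zero =>
      refine ⟨hP0 ▸ hP₀, fun x => ?_, fun z => ⟨fun _ => z, rfl, ?_⟩⟩ <;>
        simp [hP0, hx0, hc0]
    | succ t ih =>
      obtain ⟨hPt, hle, hex⟩ := ih
      obtain ⟨hP', hle', hex'⟩ := qf_filter_step hQ hPt hR F H (hPrec t) (hxrec t)
      refine ⟨hP', fun x => ?_, fun z => ?_⟩
      · rw [Finset.sum_range_succ, hcrec]
        linarith [hle x, hle' (x t) (x (t + 1))]
      · obtain ⟨a, ha⟩ := hex' z
        obtain ⟨x, hxt, hx⟩ := hex a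
        have hs : ∀ s ≤ t, Function.update x (t + 1) z s = x s := fun s hs =>
          Function.update_of_ne (by omega) _ _
        refine ⟨Function.update x (t + 1) z, Function.update_self .., ?_⟩
        rw [Finset.sum_range_succ, hcrec, hs 0 (Nat.zero_le t), hs t le_rfl, Function.update_self,
          hxt]
        rw [Finset.sum_congr rfl fun s hst => by
          rw [hs s (Finset.mem_range.1 hst).le, hs (s + 1) (Finset.mem_range.1 hst)]]
        linarith
  obtain ⟨hPN, hle, hex⟩ := key N
  obtain ⟨xs, hxs, hJ⟩ := hex (xbr N)
  rw [sub_self, qf_zero, zero_add] at hJ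
  have hub : ∀ (yh : Fin m → ℝ) (x : ℕ → Fin n → ℝ),
      (yh - H *ᵥ x N) ⬝ᵥ (yh - H *ᵥ x N) -
          γ ^ 2 * (qf P₀⁻¹ (x 0 - xh₀) +
            ∑ t ∈ Finset.range N,
              (qf Q⁻¹ (x (t + 1) - F *ᵥ x t) + qf R⁻¹ (y t - H *ᵥ x t))) ≤
        (yh - H *ᵥ xbr N) ⬝ᵥ (yh - H *ᵥ xbr N) +
          γ ^ 2 * qf (γ ^ 2 • (1 : Matrix (Fin m) (Fin m) ℝ) - H * P N * Hᵀ)⁻¹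
            (yh - H *ᵥ xbr N) - γ ^ 2 * c N := by
    intro yh x
    have h := sub_sq_le_of_posDef hPN hγ hgam (yh - H *ᵥ xbr N) (x N - xbr N)
    have he : yh - H *ᵥ xbr N - H *ᵥ (x N - xbr N) = yh - H *ᵥ x N := by rw [mulVec_sub]; abel
    rw [he] at h
    linarith [mul_le_mul_of_nonneg_left (hle x) (sq_nonneg γ)]
  have hlb : ∀ yh, (yh - H *ᵥ xbr N) ⬝ᵥ (yh - H *ᵥ xbr N) - γ ^ 2 * c N ≤ g yh := by
    intro yh
    refine le_ciSup_of_le ⟨_, Set.forall_mem_range.2 (hub yh)⟩ xs ?_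
    rw [hxs, hJ]
  have hval : g (H *ᵥ xbr N) = -(γ ^ 2 * c N) := by
    apply le_antisymm
    · refine ciSup_le fun x => (hub _ x).trans ?_
      simp [qf_zero]
    · simpa using hlb (H *ᵥ xbr N)
  refine ⟨fun yh => ?_, fun yh h => ?_, hval⟩
  · have h0 : 0 ≤ (yh - H *ᵥ xbr N) ⬝ᵥ (yh - H *ᵥ xbr N) :=
      Finset.sum_nonneg fun i _ => mul_self_nonneg _
    linarith [hlb yh]
  · have h0 : 0 ≤ (yh - H *ᵥ xbr N) ⬝ᵥ (yh - H *ᵥ xbr N) :=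
      Finset.sum_nonneg fun i _ => mul_self_nonneg _
    exact sub_eq_zero.1 (dotProduct_self_eq_zero.1 (by linarith [hlb yh]))
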